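/- arXiv:2205.08038 — 2 statements merged into one kernel-verified Lean document; each statement's English description precedes it below -/
import Mathlib

section
/- Let f : ℝⁿ → ℝ be twice continuously differentiable, let x* ∈ ℝⁿ satisfy ∇f(x*) = 0, assume the Hessian ∇²f(x*) is invertible and that ∇²f(·) is differentiable in a neighborhood of x*. Let ε : ℝⁿ → [0,∞) be a function that is constant in a neighborhood of x* and satisfies ∇²f(x*) + ε(x*)·I ≻ 0. If x* is not a local minimum of f (equivalently, given the invertibility assumption, ∇²f(x*) has a negative eigenvalue), then x* is an unstable equilibrium of the modified Newton iteration x⁺ = x − (∇²f(x) + ε(x)·I)⁻¹ ∇f(x). -/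
open Filter Topology Matrix

noncomputable section

/-- The `i`-th partial derivative of `f` at `x`. -/
def pd {n : ℕ} (f : EuclideanSpace ℝ (Fin n) → ℝ) (x : EuclideanSpace ℝ (Fin n)) (i : Fin n) : ℝ :=
  fderiv ℝ f x (EuclideanSpace.single i 1)

/-- The Hessian matrix of `f` at `x`. -/
def hessian {n : ℕ} (f : EuclideanSpace ℝ (Fin n) → ℝ) (x : EuclideanSpace ℝ (Fin n)) :
    Matrix (Fin n) (Fin n) ℝ :=
  Matrix.of fun i j => pd (fun y => pd f y j) x i

/-- The modified Newton iteration map `x ↦ x - (∇²f(x) + ε(x)·I)⁻¹ ∇f(x)`. -/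
def newtonMap {n : ℕ} (f : EuclideanSpace ℝ (Fin n) → ℝ) (ε : EuclideanSpace ℝ (Fin n) → ℝ)
    (x : EuclideanSpace ℝ (Fin n)) : EuclideanSpace ℝ (Fin n) :=
  x - (WithLp.equiv 2 (Fin n → ℝ)).symm
    ((hessian f x + ε x • (1 : Matrix (Fin n) (Fin n) ℝ))⁻¹.mulVec
      (WithLp.equiv 2 (Fin n → ℝ) (gradient f x)))

/-- Lyapunov stability of a fixed point of the discrete iteration `z⁺ = T(z)`. -/
def StableFixedPt {Z : Type*} [NormedAddCommGroup Z] (T : Z → Z) (z : Z) : Prop :=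
  ∀ η > 0, ∃ δ > 0, ∀ z₀, ‖z₀ - z‖ < δ → ∀ k : ℕ, ‖T^[k] z₀ - z‖ < η

/-- An unstable fixed point: the Lyapunov stability property fails. -/
def IsUnstableFixedPt {Z : Type*} [NormedAddCommGroup Z] (T : Z → Z) (z : Z) : Prop :=
  Function.IsFixedPt T z ∧ ¬ StableFixedPt T z

open Asymptotics in
/-- Second-order Taylor expansion at a critical point at which the gradient is differentiable. -/
theorem isLittleO_sub_half_inner_of_hasFDerivAt_gradient {E : Type*} [NormedAddCommGroup E]
    [InnerProductSpace ℝ E] [CompleteSpace E] {f : E → ℝ} {a : E} {B : E →L[ℝ] E}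
    (hf : Differentiable ℝ f) (hgrad : gradient f a = 0) (hB : HasFDerivAt (gradient f) B a)
    (hsymm : ∀ u v, inner ℝ (B u) v = inner ℝ u (B v)) :
    (fun x => f x - f a - (1 / 2) * inner ℝ (B (x - a)) (x - a)) =o[𝓝 a]
      fun x => ‖x - a‖ ^ 2 := by
  rw [isLittleO_iff]
  intro c hc
  have hlin := (hasFDerivAt_iff_isLittleO.mp hB).def hc
  obtain ⟨r, hr, hball⟩ := Metric.eventually_nhds_iff_ball.mp hlin
  filter_upwards [Metric.ball_mem_nhds a hr] with x hx
  let φ : E → ℝ := fun y => f y - (1 / 2) * inner ℝ (B (y - a)) (y - a)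
  have hderiv : ∀ y, HasFDerivAt φ (innerSL ℝ (gradient f y - B (y - a))) y := by
    intro y
    have h1 : HasFDerivAt (fun z : E => z - a) (ContinuousLinearMap.id ℝ E) y :=
      (hasFDerivAt_id y).sub_const a
    have h2 : HasFDerivAt (fun z : E => B (z - a)) B y := by
      exact B.hasFDerivAt.comp y h1
    have h3 := (hf y).hasFDerivAt.sub ((h2.inner ℝ h1).const_mul (1 / 2))
    refine h3.congr_fderiv ?_
    ext v
    have h4 := hsymm v (y - a)
    have h5 := inner_gradient_left (𝕜 := ℝ) (f := f) (x := y) (y := v)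
    have h6 := real_inner_comm v (B (y - a))
    simp only [map_sub, inner_sub_left] at h4 h6
    simp [fderivInnerCLM_apply, inner_sub_left, h5]
    linarith
  have hmv := (convex_closedBall a ‖x - a‖).norm_image_sub_le_of_norm_hasFDerivWithin_le
    (f := φ) (C := c * ‖x - a‖) (x := a) (y := x)
    (fun y _ => (hderiv y).hasFDerivWithinAt)
    (fun y hy => ?_) (by simp) (by simp [dist_eq_norm])
  · have h0 : φ x - φ a = f x - f a - (1 / 2) * inner ℝ (B (x - a)) (x - a) := by
      simp [φ]; ring
    rw [h0] at hmv
    rw [norm_pow, norm_norm]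
    calc _ ≤ _ := hmv
      _ = _ := by ring
  · have hya : ‖y - a‖ ≤ ‖x - a‖ := by simpa [dist_eq_norm] using hy
    have hyr : y ∈ Metric.ball a r := by
      rw [Metric.mem_ball, dist_eq_norm] at hx ⊢
      exact hya.trans_lt hx
    have h1 := hball y hyr
    rw [hgrad, sub_zero] at h1
    rw [innerSL_apply_norm]
    exact h1.trans (by gcongr)

/-- A quadratic form which is positive away from the origin of a finite-dimensional space is
bounded below by a multiple of the squared norm. -/
theorem exists_pos_mul_norm_sq_le {E : Type*} [NormedAddCommGroup E] [NormedSpace ℝ E]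
    [FiniteDimensional ℝ E] {q : E → ℝ} (hq : Continuous q)
    (hhom : ∀ (t : ℝ) h, q (t • h) = t ^ 2 * q h) (hpos : ∀ h, h ≠ 0 → 0 < q h) :
    ∃ c > 0, ∀ h, c * ‖h‖ ^ 2 ≤ q h := by
  have hq0 : q 0 = 0 := by simpa using hhom 0 0
  rcases subsingleton_or_nontrivial E with hE | hE
  · exact ⟨1, one_pos, fun h => by simp [Subsingleton.elim h 0, hq0]⟩
  have := FiniteDimensional.proper_real E
  obtain ⟨u, hu, hmin⟩ := (isCompact_sphere (0 : E) 1).exists_isMinOn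
    (NormedSpace.sphere_nonempty.mpr zero_le_one) hq.continuousOn
  have hu1 : ‖u‖ = 1 := by simpa using hu
  refine ⟨q u, hpos u (by rintro rfl; simp at hu1), fun h => ?_⟩
  rcases eq_or_ne h 0 with rfl | hh
  · simp [hq0]
  have hn : ‖h‖ ≠ 0 := norm_ne_zero_iff.mpr hh
  have h1 : q u ≤ q (‖h‖⁻¹ • h) := hmin (by simp [norm_smul, hn])
  calc q u * ‖h‖ ^ 2 ≤ q (‖h‖⁻¹ • h) * ‖h‖ ^ 2 := by gcongr
    _ = q h := by rw [hhom]; field_simp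

open Asymptotics in
/-- If the derivative `L` of `T` at the fixed point `a` strictly decreases the Hessian quadratic
form of `f` at the critical point `a`, then `T` decreases `f` quadratically near `a`. -/
theorem eventually_apply_le_sub_norm_sq {E : Type*} [NormedAddCommGroup E]
    [InnerProductSpace ℝ E] [FiniteDimensional ℝ E] {f : E → ℝ} {a : E} {B L : E →L[ℝ] E}
    {T : E → E} (hf : Differentiable ℝ f) (hgrad : gradient f a = 0)
    (hB : HasFDerivAt (gradient f) B a)
    (hsymm : ∀ u v, inner ℝ (B u) v = inner ℝ u (B v))
    (hfix : T a = a) (hT : HasFDerivAt T L a)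
    (hdec : ∀ h, h ≠ 0 → inner ℝ (B (L h)) (L h) < inner ℝ (B h) h) :
    ∃ c > 0, ∀ᶠ x in 𝓝 a, f (T x) ≤ f x - c * ‖x - a‖ ^ 2 := by
  obtain ⟨c, hc, hcq⟩ := exists_pos_mul_norm_sq_le
    (q := fun h => inner ℝ (B h) h - inner ℝ (B (L h)) (L h)) (by fun_prop)
    (fun t h => by simp [inner_smul_left, inner_smul_right]; ring)
    (fun h hh => sub_pos.mpr (hdec h hh))
  have htaylor := isLittleO_sub_half_inner_of_hasFDerivAt_gradient hf hgrad hB hsymm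
  have hTlin : (fun x => T x - a - L (x - a)) =o[𝓝 a] fun x => x - a := by
    simpa [hfix] using hasFDerivAt_iff_isLittleO.mp hT
  have hTO : (fun x => T x - a) =O[𝓝 a] fun x => x - a := by
    simpa [hfix] using hT.isBigO_sub
  have hLO : (fun x => L (x - a)) =O[𝓝 a] fun x => x - a := L.isBigO_comp _ _
  have htend : Tendsto T (𝓝 a) (𝓝 a) := by
    simpa [ContinuousAt, hfix] using hT.continuousAt
  have htaylorT : (fun x => f (T x) - f a - (1 / 2) * inner ℝ (B (T x - a)) (T x - a)) =o[𝓝 a]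
      fun x => ‖x - a‖ ^ 2 :=
    (htaylor.comp_tendsto htend).trans_isBigO (hTO.norm_norm.pow 2)
  have hquad : (fun x => inner ℝ (B (T x - a)) (T x - a) -
      inner ℝ (B (L (x - a))) (L (x - a))) =o[𝓝 a] fun x => ‖x - a‖ ^ 2 := by
    have hprod : (fun x => ‖T x - a - L (x - a)‖ * (‖T x - a‖ + ‖L (x - a)‖)) =o[𝓝 a]
        fun x => ‖x - a‖ ^ 2 := by
      simp_rw [pow_two]
      exact hTlin.norm_norm.mul_isBigO (hTO.norm_norm.add hLO.norm_norm)
    refine IsBigO.trans_isLittleO (IsBigO.of_bound ‖B‖ (Eventually.of_forall fun x => ?_)) hprod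
    set u := T x - a
    set v := L (x - a)
    have hsplit : inner ℝ (B u) u - inner ℝ (B v) v
        = inner ℝ (B (u - v)) u + inner ℝ (B (u - v)) v := by
      have h1 := hsymm u v
      have h2 := real_inner_comm u (B v)
      simp only [map_sub, inner_sub_left]
      linarith
    have hb : ∀ w, ‖inner ℝ (B (u - v)) w‖ ≤ ‖B‖ * ‖u - v‖ * ‖w‖ := fun w =>
      (norm_inner_le_norm _ _).trans (by gcongr; exact B.le_opNorm _)
    rw [hsplit, Real.norm_of_nonneg (by positivity : 0 ≤ ‖u - v‖ * (‖u‖ + ‖v‖))]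
    calc _ ≤ _ := norm_add_le _ _
      _ ≤ _ := add_le_add (hb u) (hb v)
      _ = _ := by ring
  refine ⟨c / 8, by positivity, ?_⟩
  have hc8 : 0 < c / 8 := by positivity
  filter_upwards [htaylor.def hc8, htaylorT.def hc8, hquad.def hc8] with x h1 h2 h3
  rw [norm_pow, norm_norm, Real.norm_eq_abs, abs_le] at h1 h2 h3
  have h4 := hcq (x - a)
  linarith [h1.1, h2.2, h3.2]

/-- A fixed point that is not a local minimum of a function decreasing quadratically along the
iteration is not Lyapunov stable. -/
theorem not_stableFixedPt_of_eventually_apply_le {E : Type*} [NormedAddCommGroup E]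
    {f : E → ℝ} {a : E} {T : E → E} {c : ℝ} (hf : ContinuousAt f a) (hc : 0 < c)
    (hdec : ∀ᶠ x in 𝓝 a, f (T x) ≤ f x - c * ‖x - a‖ ^ 2)
    (hnotmin : ¬ ∃ δ > 0, ∀ x, ‖x - a‖ < δ → f a ≤ f x) :
    ¬ StableFixedPt T a := by
  intro hstable
  obtain ⟨r, hr, hball⟩ := Metric.eventually_nhds_iff.mp
    (hdec.and (hf.eventually (lt_mem_nhds (sub_one_lt (f a)))))
  simp only [dist_eq_norm] at hball
  obtain ⟨δ, hδ, horbit⟩ := hstable r hr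
  push Not at hnotmin
  obtain ⟨x, hxδ, hfx⟩ := hnotmin δ hδ
  obtain ⟨ρ, hρ, hnear⟩ := Metric.eventually_nhds_iff.mp (hf.eventually (lt_mem_nhds hfx))
  simp only [dist_eq_norm] at hnear
  have hx := horbit x hxδ
  have hdesc : ∀ k : ℕ, f (T^[k] x) ≤ f x - k * (c * ρ ^ 2) := by
    intro k
    induction k with
    | zero => simp
    | succ k ih =>
      have hle : f (T^[k] x) ≤ f x := ih.trans (sub_le_self _ (by positivity))
      have hfar : ρ ≤ ‖T^[k] x - a‖ := by
        by_contra! h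
        exact absurd (hnear h) (not_lt.mpr hle)
      have hstep := (hball (hx k)).1
      have hmul : c * ρ ^ 2 ≤ c * ‖T^[k] x - a‖ ^ 2 := by gcongr
      rw [Function.iterate_succ_apply']
      push_cast
      linarith
  obtain ⟨k, hk⟩ := exists_nat_gt (1 / (c * ρ ^ 2))
  rw [div_lt_iff₀ (by positivity)] at hk
  linarith [hdesc k, (hball (hx k)).2]

open Asymptotics in
/-- The derivative of `x ↦ x - P x (g x)` at a zero of `g`, with `P` merely continuous there. -/
theorem hasFDerivAt_sub_clm_apply {E : Type*} [NormedAddCommGroup E] [NormedSpace ℝ E]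
    {g : E → E} {P : E → E →L[ℝ] E} {a : E} {B : E →L[ℝ] E} (hg : HasFDerivAt g B a)
    (hga : g a = 0) (hP : ContinuousAt P a) :
    HasFDerivAt (fun x => x - P x (g x)) (ContinuousLinearMap.id ℝ E - (P a).comp B) a := by
  refine (hasFDerivAt_id a).sub ?_
  rw [hasFDerivAt_iff_isLittleO]
  have hgO : g =O[𝓝 a] fun x => x - a := by simpa [hga] using hg.isBigO_sub
  have h1 : (fun x => (P x - P a) (g x)) =o[𝓝 a] fun x => x - a := by
    have hPo : (fun x => P x - P a) =o[𝓝 a] fun _ => (1 : ℝ) := by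
      rw [isLittleO_one_iff]
      simpa [ContinuousAt] using Tendsto.sub_const hP (P a)
    refine IsBigO.trans_isLittleO (IsBigO.of_bound 1 (Eventually.of_forall fun x => ?_))
      ((hPo.norm_left.mul_isBigO hgO.norm_norm).congr_right (g₂ := fun x => ‖x - a‖)
        (fun x => one_mul _)) |>.of_norm_right
    simpa using (P x - P a).le_opNorm (g x)
  have h2 : (fun x => P a (g x - g a - B (x - a))) =o[𝓝 a] fun x => x - a :=
    ((P a).isBigO_comp _ _).trans_isLittleO (hasFDerivAt_iff_isLittleO.mp hg)
  refine (h1.add h2).congr_left fun x => ?_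
  simp [hga]

/-- The coordinates of the gradient are the partial derivatives. -/
theorem gradient_apply_eq_pd {n : ℕ} (f : EuclideanSpace ℝ (Fin n) → ℝ)
    (x : EuclideanSpace ℝ (Fin n)) (i : Fin n) :
    gradient f x i = pd f x i := by
  rw [pd, ← inner_gradient_left, EuclideanSpace.inner_single_right]
  simp

/-- The derivative of the gradient is the transpose of the Hessian matrix. -/
theorem hasFDerivAt_gradient_hessian {n : ℕ} {f : EuclideanSpace ℝ (Fin n) → ℝ}
    (hf : ContDiff ℝ 2 f) (x : EuclideanSpace ℝ (Fin n)) :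
    HasFDerivAt (gradient f) (Matrix.toEuclideanCLM (𝕜 := ℝ) (hessian f x)ᵀ) x := by
  have hpd : ∀ j, Differentiable ℝ (fun y => pd f y j) := fun j =>
    ((hf.fderiv_right (m := 1) (by norm_num)).clm_apply contDiff_const).differentiable
      (by norm_num)
  rw [← hasFDerivWithinAt_univ, hasFDerivWithinAt_euclidean]
  intro j
  rw [hasFDerivWithinAt_univ]
  have hgj : (fun y => gradient f y j) = fun y => pd f y j :=
    funext fun y => gradient_apply_eq_pd f y j
  rw [hgj]
  refine (hpd j x).hasFDerivAt.congr_fderiv ?_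
  ext v
  have hv : v = ∑ i, v i • EuclideanSpace.single i (1 : ℝ) := by
    ext k; simp [Pi.single_apply]
  conv_lhs => rw [hv, map_sum]
  simp [hessian, pd, Matrix.mulVec, dotProduct, mul_comm]

/-- **Theorem (instability part)**: at an equilibrium point of the modified Newton iteration
that is not a local minimum, the iteration is unstable. -/
theorem newton_unstable_of_not_localMin {n : ℕ}
    (f : EuclideanSpace ℝ (Fin n) → ℝ) (xs : EuclideanSpace ℝ (Fin n))
    (ε : EuclideanSpace ℝ (Fin n) → ℝ)
    (hf : ContDiff ℝ 2 f)
    (hgrad : gradient f xs = 0)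
    (hinv : IsUnit (hessian f xs).det)
    (hHdiff : ∀ᶠ y in 𝓝 xs, ∀ i j, DifferentiableAt ℝ (fun w => hessian f w i j) y)
    (hε0 : ∀ x, 0 ≤ ε x)
    (hεconst : ∀ᶠ y in 𝓝 xs, ε y = ε xs)
    (hpd : (hessian f xs + ε xs • (1 : Matrix (Fin n) (Fin n) ℝ)).PosDef)
    (hnotmin : ¬ ∃ δ > 0, ∀ x, ‖x - xs‖ < δ → f xs ≤ f x) :
    IsUnstableFixedPt (newtonMap f ε) xs := by
  have hdf : Differentiable ℝ f := hf.differentiable (by norm_num)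
  have hfix : newtonMap f ε xs = xs := by simp [newtonMap, hgrad]
  refine ⟨hfix, ?_⟩
  set H := hessian f xs with hH
  set M := H + ε xs • (1 : Matrix (Fin n) (Fin n) ℝ) with hM
  have hMdet : IsUnit M.det := hpd.isUnit.map Matrix.detMonoidHom
  have hHsymm : Hᵀ = H := by
    have h := hpd.isHermitian
    rw [Matrix.IsHermitian, Matrix.conjTranspose_eq_transpose_of_trivial, hM,
      Matrix.transpose_add, Matrix.transpose_smul, Matrix.transpose_one] at h
    exact add_right_cancel h
  let Φ := Matrix.toEuclideanCLM (n := Fin n) (𝕜 := ℝ)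
  have hB : HasFDerivAt (gradient f) (Φ H) xs := by
    simpa [← hH, hHsymm] using hasFDerivAt_gradient_hessian hf xs
  have hsymm : ∀ u v, inner ℝ (Φ H u) v = inner ℝ u (Φ H v) := by
    intro u v
    rw [real_inner_comm, Matrix.inner_toEuclideanCLM, Matrix.inner_toEuclideanCLM,
      Matrix.dotProduct_mulVec, ← Matrix.mulVec_transpose, hHsymm, dotProduct_comm]
  have hΦ : Continuous Φ := Φ.toAlgEquiv.toLinearMap.continuous_of_finiteDimensional
  have hcont : ContinuousAt (fun x => Φ (hessian f x + ε x • 1)⁻¹) xs := by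
    have hhess : ContinuousAt (hessian f) xs :=
      continuousAt_pi.mpr fun i => continuousAt_pi.mpr fun j =>
        (hHdiff.self_of_nhds i j).continuousAt
    have hε : ContinuousAt ε xs :=
      (continuousAt_const (y := ε xs)).congr (hεconst.mono fun _ h => h.symm)
    have hA : ContinuousAt (fun x => hessian f x + ε x • (1 : Matrix (Fin n) (Fin n) ℝ)) xs :=
      hhess.add (hε.smul continuousAt_const)
    have hinvM : ContinuousAt (fun A : Matrix (Fin n) (Fin n) ℝ => A⁻¹) M := by
      simp_rw [Matrix.inv_def, Ring.inverse_eq_inv']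
      exact ((continuous_id.matrix_det.continuousAt).inv₀ hMdet.ne_zero).smul
        continuous_id.matrix_adjugate.continuousAt
    exact hΦ.continuousAt.comp (hinvM.comp hA)
  have hT : HasFDerivAt (newtonMap f ε)
      (ContinuousLinearMap.id ℝ _ - (Φ M⁻¹).comp (Φ H)) xs :=
    hasFDerivAt_sub_clm_apply hB hgrad hcont
  suffices hL : ∀ h, h ≠ 0 → inner ℝ (Φ H (h - Φ M⁻¹ (Φ H h))) (h - Φ M⁻¹ (Φ H h)) <
      inner ℝ (Φ H h) h by
    obtain ⟨c, hc, hdec⟩ := eventually_apply_le_sub_norm_sq hdf hgrad hB hsymm hfix hT hL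
    exact not_stableFixedPt_of_eventually_apply_le hdf.continuous.continuousAt hc hdec hnotmin
  intro h hh
  obtain ⟨w, hw⟩ : ∃ w, w = Φ M⁻¹ (Φ H h) := ⟨_, rfl⟩
  have hΦM : Φ M w = Φ H h := by
    rw [hw, ← mul_apply_eq_comp, ← map_mul, Matrix.mul_nonsing_inv _ hMdet, map_one,
      one_apply_eq_self]
  have hΦMw : Φ H h = Φ H w + ε xs • w := by
    rw [← hΦM, hM, map_add, map_smul, map_one]
    rfl
  have hw0 : w ≠ 0 := by
    rintro rfl
    apply hh
    have h1 : Φ H h = 0 := by simpa using hΦMw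
    have h2 : Φ H⁻¹ (Φ H h) = h := by
      rw [← mul_apply_eq_comp, ← map_mul, Matrix.nonsing_inv_mul _ hinv, map_one,
        one_apply_eq_self]
    rw [← h2, h1, map_zero]
  have hpos : 0 < inner ℝ w (Φ H h) := by
    rw [← hΦM, Matrix.inner_toEuclideanCLM]
    have hw1 : WithLp.ofLp w ≠ 0 := by simpa using hw0
    simpa using hpd.dotProduct_mulVec_pos hw1
  have hεw : 0 ≤ ε xs * inner ℝ w w := mul_nonneg (hε0 xs) real_inner_self_nonneg
  have hexp : inner ℝ w (Φ H h) = inner ℝ w (Φ H w) + ε xs * inner ℝ w w := by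
    rw [hΦMw, inner_add_right, inner_smul_right]
  have e1 := hsymm w h
  have e2 := real_inner_comm w (Φ H h)
  have e3 := hsymm w w
  simp only [← hw, map_sub, inner_sub_left, inner_sub_right]
  linarith
end
end

section
/- Consider the constrained minimization min f(x) over {x ∈ ℝⁿ : G(x) = 0, F(x) ≤ 0}, with f, G : ℝⁿ → ℝˡ, F : ℝⁿ → ℝᵐ twice continuously differentiable. Let b > 0 and let z* = (x, s, ν, λ) satisfy g(z*, b) = 0. Assume the LICQ and strict complementarity hold at z*, that J_zz f(z*) is invertible, and that J_zz f(·) is differentiable in a neighborhood of z*. Let ε : z ↦ ε(z) ≥ 0 be constant in a neighborhood of z* and satisfy inertia(J_zz f(z*) + E(z*)) = (n+m, l+m, 0). If the second-order sufficient conditions for a local minimum hold at z*, namely inertia(J_zz f(z*)) = (n+m, l+m, 0), then z* is a locally asymptotically stable equilibrium of the primal-dual interior-point iteration z⁺ = z − (J_zz f(z) + E(z))⁻¹ S(z)⁻¹ g(z, b) (with step size α = 1 and b fixed). -/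
open Filter Topology Matrix

noncomputable section

/-- The real symmetric matrix `A` has inertia `t = (n₊, n₋, n₀)`. -/
def HasInertia {ι : Type*} [Fintype ι] [DecidableEq ι] (A : Matrix ι ι ℝ)
    (t : ℕ × ℕ × ℕ) : Prop :=
  ∃ hA : A.IsHermitian,
    Nat.card {i // 0 < hA.eigenvalues i} = t.1 ∧
    Nat.card {i // hA.eigenvalues i < 0} = t.2.1 ∧
    Nat.card {i // hA.eigenvalues i = 0} = t.2.2

/-- Local asymptotic stability: fixed point, stability, and local attractivity. -/
def IsLASFixedPt {Z : Type*} [NormedAddCommGroup Z] (T : Z → Z) (z : Z) : Prop :=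
  Function.IsFixedPt T z ∧ StableFixedPt T z ∧
    ∃ δ > 0, ∀ z₀, ‖z₀ - z‖ < δ → Tendsto (fun k => T^[k] z₀) atTop (𝓝 z)

variable {n l m : ℕ}

/-- The primal-dual variables `z = (x, s, ν, λ)`. -/
abbrev ZMin (n l m : ℕ) :=
  EuclideanSpace ℝ (Fin n) × (Fin m → ℝ) × (Fin l → ℝ) × (Fin m → ℝ)

/-- Index type matching the block structure `(x, s, ν, λ)`. -/
abbrev ιMin (n l m : ℕ) := (Fin n ⊕ Fin m) ⊕ (Fin l ⊕ Fin m)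

/-- The Lagrangian `L(z) = f(x) + ν'G(x) + λ'(F(x)+s)`, as a function of `x`. -/
def LagrangianMin (f : EuclideanSpace ℝ (Fin n) → ℝ) (G : EuclideanSpace ℝ (Fin n) → Fin l → ℝ)
    (F : EuclideanSpace ℝ (Fin n) → Fin m → ℝ) (z : ZMin n l m) :
    EuclideanSpace ℝ (Fin n) → ℝ :=
  fun x => f x + (∑ j, z.2.2.1 j * G x j) + ∑ i, z.2.2.2 i * (F x i + z.2.1 i)

/-- The vector `g(z,b) = (∇ₓL(z); λ⊙s − b·1; G(x); F(x)+s)`. -/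
def gMin (f : EuclideanSpace ℝ (Fin n) → ℝ) (G : EuclideanSpace ℝ (Fin n) → Fin l → ℝ)
    (F : EuclideanSpace ℝ (Fin n) → Fin m → ℝ) (z : ZMin n l m) (b : ℝ) : ιMin n l m → ℝ :=
  Sum.elim
    (Sum.elim (fun i => gradient (LagrangianMin f G F z) z.1 i)
      (fun i => z.2.2.2 i * z.2.1 i - b))
    (Sum.elim (fun j => G z.1 j) (fun i => F z.1 i + z.2.1 i))

/-- The matrix `J_zz f(z)` of the primal-dual interior-point method. -/
def JzzMin (f : EuclideanSpace ℝ (Fin n) → ℝ) (G : EuclideanSpace ℝ (Fin n) → Fin l → ℝ)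
    (F : EuclideanSpace ℝ (Fin n) → Fin m → ℝ) (z : ZMin n l m) :
    Matrix (ιMin n l m) (ιMin n l m) ℝ :=
  Matrix.fromBlocks
    (Matrix.fromBlocks (hessian (LagrangianMin f G F z) z.1) 0 0
      (Matrix.diagonal fun i => z.2.2.2 i / z.2.1 i))
    (Matrix.fromBlocks (Matrix.of fun i j => pd (fun x' => G x' j) z.1 i)
      (Matrix.of fun i j => pd (fun x' => F x' j) z.1 i) 0 1)
    (Matrix.fromBlocks (Matrix.of fun i j => pd (fun x' => G x' j) z.1 i)
      (Matrix.of fun i j => pd (fun x' => F x' j) z.1 i) 0 1)ᵀ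
    0

/-- The modification matrix `E(z) = diag(ε(z)·1ₙ, 0)`. -/
def EMin (ε : ZMin n l m → ℝ) (z : ZMin n l m) : Matrix (ιMin n l m) (ιMin n l m) ℝ :=
  Matrix.diagonal (Sum.elim (Sum.elim (fun _ => ε z) (fun _ => 0)) (fun _ => 0))

/-- The scaling matrix `S(z) = diag(1ₙ, s, 1_{l+m})`. -/
def SMin (z : ZMin n l m) : Matrix (ιMin n l m) (ιMin n l m) ℝ :=
  Matrix.diagonal (Sum.elim (Sum.elim (fun _ => 1) z.2.1) (fun _ => 1))

/-- The modified primal-dual interior-point iteration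
`z⁺ = z − (J_zz f(z) + E(z))⁻¹ S(z)⁻¹ g(z,b)`, with step size `α = 1`. -/
def ipMinMap (f : EuclideanSpace ℝ (Fin n) → ℝ) (G : EuclideanSpace ℝ (Fin n) → Fin l → ℝ)
    (F : EuclideanSpace ℝ (Fin n) → Fin m → ℝ) (ε : ZMin n l m → ℝ) (b : ℝ)
    (z : ZMin n l m) : ZMin n l m :=
  let d : ιMin n l m → ℝ :=
    (JzzMin f G F z + EMin ε z)⁻¹.mulVec ((SMin z)⁻¹.mulVec (gMin f G F z b))
  ((WithLp.equiv 2 (Fin n → ℝ)).symm fun i => z.1 i - d (Sum.inl (Sum.inl i)),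
    fun i => z.2.1 i - d (Sum.inl (Sum.inr i)),
    fun j => z.2.2.1 j - d (Sum.inr (Sum.inl j)),
    fun i => z.2.2.2 i - d (Sum.inr (Sum.inr i)))

/-- The quadratic form of a real symmetric matrix in coordinates along its eigenvectors. -/
theorem dotProduct_mulVec_eq_sum_eigenvalues {ι : Type*} [Fintype ι] [DecidableEq ι]
    {A : Matrix ι ι ℝ} (hA : A.IsHermitian) (v : ι → ℝ) :
    v ⬝ᵥ A *ᵥ v = ∑ i, hA.eigenvalues i *
      ((star (hA.eigenvectorUnitary : Matrix ι ι ℝ) *ᵥ v) i) ^ 2 := by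
  have hv : v ᵥ* (hA.eigenvectorUnitary : Matrix ι ι ℝ) =
      star (hA.eigenvectorUnitary : Matrix ι ι ℝ) *ᵥ v := by
    rw [star_eq_conjTranspose, conjTranspose_eq_transpose_of_trivial, mulVec_transpose]
  conv_lhs => rw [hA.spectral_theorem, Unitary.conjStarAlgAut_apply]
  rw [← mulVec_mulVec, ← mulVec_mulVec, dotProduct_mulVec, hv]
  simp only [dotProduct, mulVec_diagonal, Function.comp_apply, RCLike.ofReal_real_eq_id, id]
  exact Finset.sum_congr rfl fun i _ => by ring

/-- A symmetric matrix whose inertia has no zero part is invertible. -/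
theorem HasInertia.isUnit_det {ι : Type*} [Fintype ι] [DecidableEq ι] {A : Matrix ι ι ℝ}
    {p q : ℕ} (h : HasInertia A (p, q, 0)) : IsUnit A.det := by
  obtain ⟨hA, -, -, h0⟩ := h
  have hne : ∀ i, hA.eigenvalues i ≠ 0 := fun i hi => by
    rw [Nat.card_eq_fintype_card, Fintype.card_eq_zero_iff] at h0
    exact h0.elim ⟨i, hi⟩
  rw [hA.det_eq_prod_eigenvalues, isUnit_iff_ne_zero]
  exact Finset.prod_ne_zero_iff.2 fun i _ => by simpa using hne i

/-- A saddle-point matrix with as many negative eigenvalues as it has constraints, and no zero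
eigenvalue, is positive definite on the kernel of the constraints. -/
theorem HasInertia.pos_of_transpose_mulVec_eq_zero {κ ρ : Type*} [Fintype κ] [DecidableEq κ]
    [Fintype ρ] [DecidableEq ρ] {H : Matrix κ κ ℝ} {A : Matrix κ ρ ℝ} {p : ℕ}
    (h : HasInertia (fromBlocks H A Aᵀ 0) (p, Fintype.card ρ, 0))
    {w : κ → ℝ} (hw : w ≠ 0) (hAw : Aᵀ *ᵥ w = 0) : 0 < w ⬝ᵥ H *ᵥ w := by
  obtain ⟨hJ, -, hneg, h0⟩ := h
  set J := fromBlocks H A Aᵀ 0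
  have hne : ∀ i, hJ.eigenvalues i ≠ 0 := fun i hi => by
    rw [Nat.card_eq_fintype_card, Fintype.card_eq_zero_iff] at h0
    exact h0.elim ⟨i, hi⟩
  by_contra! hle
  let B : Matrix (κ ⊕ ρ) (Unit ⊕ ρ) ℝ := fromBlocks (of fun i _ => w i) 0 0 1
  let U : Matrix (κ ⊕ ρ) (κ ⊕ ρ) ℝ := hJ.eigenvectorUnitary
  let Φ : (Unit ⊕ ρ → ℝ) →ₗ[ℝ] ({i // hJ.eigenvalues i < 0} → ℝ) :=
    LinearMap.funLeft ℝ ℝ Subtype.val ∘ₗ (star U * B).mulVecLin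
  have hker : LinearMap.ker Φ ≠ ⊥ := by
    apply LinearMap.ker_ne_bot_of_finrank_lt
    rw [Module.finrank_fintype_fun_eq_card, Module.finrank_fintype_fun_eq_card,
      ← Nat.card_eq_fintype_card, hneg]
    simp
  obtain ⟨y, hy, hy0⟩ := Submodule.exists_mem_ne_zero_of_ne_bot hker
  have hBy : B *ᵥ y = Sum.elim (y (Sum.inl ()) • w) (y ∘ Sum.inr) := by
    ext (i | i)
    · simp [B, mulVec, dotProduct, mul_comm]
    · simp [B, fromBlocks_mulVec]
  have hc : star U *ᵥ (B *ᵥ y) ≠ 0 := by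
    intro hz
    have hBy0 : B *ᵥ y = 0 := by
      have hU : U * star U = 1 := Unitary.coe_mul_star_self _
      have := congrArg (fun v => U *ᵥ v) hz
      rwa [mulVec_mulVec, hU, one_mulVec, mulVec_zero] at this
    rw [hBy] at hBy0
    have hl : y (Sum.inl ()) • w = 0 := funext fun i => congrFun hBy0 (Sum.inl i)
    have hr : ∀ i, y (Sum.inr i) = 0 := fun i => congrFun hBy0 (Sum.inr i)
    refine hy0 (funext ?_)
    rintro (⟨⟩ | i)
    · exact (smul_eq_zero.1 hl).resolve_right hw
    · exact hr i
  have hpos : 0 < (B *ᵥ y) ⬝ᵥ J *ᵥ (B *ᵥ y) := by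
    rw [dotProduct_mulVec_eq_sum_eigenvalues hJ]
    have hterm : ∀ i, (star U *ᵥ (B *ᵥ y)) i ≠ 0 → 0 < hJ.eigenvalues i := by
      intro i hi
      refine (lt_or_gt_of_ne (hne i)).resolve_left fun hi' => hi ?_
      have := congrFun (LinearMap.mem_ker.1 hy) ⟨i, hi'⟩
      simpa [Φ, LinearMap.funLeft_apply, ← mulVec_mulVec] using this
    obtain ⟨i, hi⟩ := Function.ne_iff.1 hc
    refine Finset.sum_pos' (fun j _ => ?_)
      ⟨i, Finset.mem_univ _, mul_pos (hterm i hi) (sq_pos_iff.2 hi)⟩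
    by_cases hj : (star U *ᵥ (B *ᵥ y)) j = 0
    · exact le_of_eq (by simp [U] at hj; simp [hj])
    · exact mul_nonneg (hterm j hj).le (sq_nonneg _)
  have hval : (B *ᵥ y) ⬝ᵥ J *ᵥ (B *ᵥ y) = y (Sum.inl ()) ^ 2 * (w ⬝ᵥ H *ᵥ w) := by
    have hAt : w ⬝ᵥ A *ᵥ (y ∘ Sum.inr) = 0 := by
      rw [dotProduct_mulVec, ← mulVec_transpose, hAw, zero_dotProduct]
    rw [hBy, fromBlocks_mulVec, sumElim_dotProduct_sumElim]
    simp only [Sum.elim_comp_inl, Sum.elim_comp_inr, mulVec_smul, hAw, smul_zero, zero_mulVec,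
      add_zero, dotProduct_zero, dotProduct_add, smul_dotProduct, dotProduct_smul, hAt,
      smul_eq_mul]
    ring
  rw [hval] at hpos
  exact absurd hpos (not_lt.2 (mul_nonpos_of_nonneg_of_nonpos (sq_nonneg _) hle))

/-- A quadratic form that is positive on the kernel of a matrix is coercive there. -/
theorem exists_coercive_on_ker {κ ρ : Type*} [Fintype κ] [Fintype ρ] {H : Matrix κ κ ℝ}
    {B : Matrix ρ κ ℝ} (h : ∀ w : κ → ℝ, w ≠ 0 → B *ᵥ w = 0 → 0 < w ⬝ᵥ H *ᵥ w) :
    ∃ c > 0, ∀ w : κ → ℝ, B *ᵥ w = 0 → c * ‖w‖ ^ 2 ≤ w ⬝ᵥ H *ᵥ w := by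
  have hcpt : IsCompact (Metric.sphere (0 : κ → ℝ) 1 ∩ {w | B *ᵥ w = 0}) :=
    (isCompact_sphere _ _).inter_right
      (isClosed_eq (Continuous.matrix_mulVec continuous_const continuous_id) continuous_const)
  have hcont : Continuous fun w : κ → ℝ => w ⬝ᵥ H *ᵥ w :=
    continuous_id.dotProduct (Continuous.matrix_mulVec continuous_const continuous_id)
  obtain ⟨c, hc, hcw⟩ : ∃ c > 0, ∀ w ∈ Metric.sphere (0 : κ → ℝ) 1 ∩ {w | B *ᵥ w = 0},
      c ≤ w ⬝ᵥ H *ᵥ w := by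
    rcases (Metric.sphere (0 : κ → ℝ) 1 ∩ {w | B *ᵥ w = 0}).eq_empty_or_nonempty with he | hne
    · exact ⟨1, one_pos, by simp [he]⟩
    · obtain ⟨w, hw, hmin⟩ := hcpt.exists_isMinOn hne hcont.continuousOn
      refine ⟨_, h w ?_ hw.2, fun v hv => hmin hv⟩
      rintro rfl
      simp at hw
  refine ⟨c, hc, fun w hBw => ?_⟩
  rcases eq_or_ne w 0 with rfl | hw
  · simp
  have hn : ‖w‖ ≠ 0 := norm_ne_zero_iff.2 hw
  have := hcw (‖w‖⁻¹ • w) ⟨by simp [norm_smul, hn], by simp [mulVec_smul, hBw]⟩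
  simp only [mulVec_smul, smul_dotProduct, dotProduct_smul, smul_eq_mul] at this
  calc c * ‖w‖ ^ 2 ≤ (‖w‖⁻¹ * (‖w‖⁻¹ * (w ⬝ᵥ H *ᵥ w))) * ‖w‖ ^ 2 := by gcongr
    _ = w ⬝ᵥ H *ᵥ w := by field_simp

/-- The seminorm bound `‖r ⊙ u‖ ≤ θ ‖r ⊙ v‖` for the solution `u` of the saddle-point system
regularized by `diag(r²)` with right-hand side `(r² ⊙ v, 0)`. -/
theorem exists_contraction_of_regularized {κ ρ : Type*} [Fintype κ] [DecidableEq κ] [Fintype ρ]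
    [DecidableEq ρ] {H : Matrix κ κ ℝ} {A : Matrix κ ρ ℝ} {p : ℕ}
    (h : HasInertia (fromBlocks H A Aᵀ 0) (p, Fintype.card ρ, 0)) (r : κ → ℝ) :
    ∃ θ, 0 ≤ θ ∧ θ < 1 ∧ ∀ (u v : κ ⊕ ρ → ℝ),
      (fromBlocks (H + diagonal (r ^ 2)) A Aᵀ 0) *ᵥ u
        = (fromBlocks (diagonal (r ^ 2)) 0 0 0 : Matrix (κ ⊕ ρ) (κ ⊕ ρ) ℝ) *ᵥ v →
      ‖WithLp.toLp 2 (r * (u ∘ Sum.inl))‖ ≤ θ * ‖WithLp.toLp 2 (r * (v ∘ Sum.inl))‖ := by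
  obtain ⟨c, hc, hcw⟩ := exists_coercive_on_ker (H := H) (B := Aᵀ)
    fun w hw hAw => h.pos_of_transpose_mulVec_eq_zero hw hAw
  let L : (κ → ℝ) →L[ℝ] EuclideanSpace ℝ κ :=
    LinearMap.toContinuousLinearMap
      ((WithLp.linearEquiv 2 ℝ (κ → ℝ)).symm.toLinearMap ∘ₗ LinearMap.mulLeft ℝ r)
  have hL : ∀ w, L w = WithLp.toLp 2 (r * w) := fun w => rfl
  set K := ‖L‖ ^ 2 + 1 with hK
  have hKpos : 0 < K := by positivity
  have hθ : 1 < 1 + c / K := by have := div_pos hc hKpos; linarith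
  refine ⟨(1 + c / K)⁻¹, by positivity, inv_lt_one_of_one_lt₀ hθ, fun u v huv => ?_⟩
  rw [fromBlocks_mulVec, fromBlocks_mulVec] at huv
  set w := u ∘ Sum.inl with hw
  have hl : (H + diagonal (r ^ 2)) *ᵥ w + A *ᵥ (u ∘ Sum.inr)
      = diagonal (r ^ 2) *ᵥ (v ∘ Sum.inl) := by
    ext i; simpa using congrFun huv (Sum.inl i)
  have hr : Aᵀ *ᵥ w = 0 := by
    ext i; simpa using congrFun huv (Sum.inr i)
  have hip : ∀ a b : κ → ℝ, a ⬝ᵥ diagonal (r ^ 2) *ᵥ b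
      = inner ℝ (WithLp.toLp 2 (r * a)) (WithLp.toLp 2 (r * b)) := by
    intro a b
    simp only [dotProduct, mulVec_diagonal, PiLp.inner_apply, Pi.mul_apply, Pi.pow_apply]
    exact Finset.sum_congr rfl fun i _ => by simp; ring
  have hdot := congrArg (fun z => w ⬝ᵥ z) hl
  have hAt : w ⬝ᵥ A *ᵥ (u ∘ Sum.inr) = 0 := by
    rw [dotProduct_mulVec, ← mulVec_transpose, hr, zero_dotProduct]
  simp only [add_mulVec, dotProduct_add, hAt, hip, add_zero, real_inner_self_eq_norm_sq] at hdot
  set a := ‖WithLp.toLp 2 (r * w)‖ with ha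
  have hcs := real_inner_le_norm (WithLp.toLp 2 (r * w)) (WithLp.toLp 2 (r * (v ∘ Sum.inl)))
  set a' := ‖WithLp.toLp 2 (r * (v ∘ Sum.inl))‖ with ha'
  have ha0 : 0 ≤ a := norm_nonneg _
  have hLw : a ^ 2 ≤ K * ‖w‖ ^ 2 := by
    have h1 : a ≤ ‖L‖ * ‖w‖ := by rw [ha, ← hL]; exact L.le_opNorm w
    calc a ^ 2 ≤ (‖L‖ * ‖w‖) ^ 2 := by gcongr
      _ ≤ K * ‖w‖ ^ 2 := by rw [mul_pow, hK]; nlinarith [sq_nonneg ‖w‖]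
  have hH : c / K * a ^ 2 ≤ w ⬝ᵥ H *ᵥ w := by
    calc c / K * a ^ 2 ≤ c / K * (K * ‖w‖ ^ 2) := by gcongr
      _ = c * ‖w‖ ^ 2 := by field_simp
      _ ≤ _ := hcw w hr
  rw [inv_mul_eq_div, le_div_iff₀ (by positivity)]
  rcases ha0.eq_or_lt with h0 | h0
  · rw [← h0]; simp [ha']
  · refine le_of_mul_le_mul_left ?_ h0
    nlinarith

/-- Linearized stability: a fixed point is locally asymptotically stable when the derivative there
contracts a seminorm `‖R ·‖` that controls its values. -/
theorem isLASFixedPt_of_hasFDerivAt {Z W : Type*} [NormedAddCommGroup Z] [NormedSpace ℝ Z]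
    [NormedAddCommGroup W] [NormedSpace ℝ W] {T : Z → Z} {z : Z} {M : Z →L[ℝ] Z}
    (hfix : Function.IsFixedPt T z) (hT : HasFDerivAt T M z) (R : Z →L[ℝ] W) {θ C : ℝ}
    (hθ0 : 0 ≤ θ) (hθ1 : θ < 1) (hR : ∀ v, ‖R (M v)‖ ≤ θ * ‖R v‖)
    (hM : ∀ v, ‖M v‖ ≤ C * ‖R v‖) : IsLASFixedPt T z := by
  obtain ⟨c, hc, hcC⟩ : ∃ c > 0, θ + c * C ≤ (1 + θ) / 2 := by
    refine ⟨(1 - θ) / (2 * (|C| + 1)), by have := sub_pos.2 hθ1; positivity, ?_⟩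
    have h1 : (1 - θ) / (2 * (|C| + 1)) * C ≤ (1 - θ) / 2 := by
      rw [div_mul_eq_mul_div, div_le_div_iff₀ (by positivity) two_pos]
      nlinarith [le_abs_self C, sub_pos.2 hθ1]
    linarith
  set q := (1 + θ) / 2 with hq
  have hq0 : 0 < q := by positivity
  have hq1 : q < 1 := by rw [hq]; linarith
  set D := ‖R‖ + c with hD
  have hD0 : 0 < D := by positivity
  let V : Z → ℝ := fun v => ‖R v‖ + c * ‖v‖
  have hVlow : ∀ v, c * ‖v‖ ≤ V v := fun v => le_add_of_nonneg_left (norm_nonneg _)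
  have hVup : ∀ v, V v ≤ D * ‖v‖ := fun v => by
    simp only [V, hD, add_mul]; gcongr; exact R.le_opNorm v
  have hVadd : ∀ v w, V (v + w) ≤ V v + V w := fun v w => by
    have h1 := norm_add_le (R v) (R w)
    have h2 := mul_le_mul_of_nonneg_left (norm_add_le v w) hc.le
    simp only [V, map_add]; linarith
  obtain ⟨r, hr, hstep⟩ : ∃ r > 0, ∀ w, ‖w - z‖ < r → V (T w - z) ≤ q * V (w - z) := by
    have hκ : 0 < c * q / D := by positivity
    obtain ⟨r, hr, hball⟩ := Metric.eventually_nhds_iff.1 (hT.isLittleO.def hκ)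
    refine ⟨r, hr, fun w hw => ?_⟩
    have he := hball (by rwa [dist_eq_norm])
    rw [hfix.eq] at he
    have hVM : V (M (w - z)) ≤ q * ‖R (w - z)‖ := by
      calc V (M (w - z)) ≤ θ * ‖R (w - z)‖ + c * (C * ‖R (w - z)‖) := by
            simp only [V]; gcongr; exacts [hR _, hM _]
        _ = (θ + c * C) * ‖R (w - z)‖ := by ring
        _ ≤ q * ‖R (w - z)‖ := by gcongr
    calc V (T w - z) = V (M (w - z) + (T w - z - M (w - z))) := by congr 1; abel
      _ ≤ V (M (w - z)) + V (T w - z - M (w - z)) := hVadd _ _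
      _ ≤ q * ‖R (w - z)‖ + D * (c * q / D * ‖w - z‖) :=
          add_le_add hVM ((hVup _).trans (by gcongr))
      _ = q * V (w - z) := by simp only [V]; field_simp
  have hiter : ∀ w, V (w - z) < c * r → ∀ k : ℕ, V (T^[k] w - z) ≤ q ^ k * V (w - z) := by
    intro w hw k
    have hV0 : 0 ≤ V (w - z) := (mul_nonneg hc.le (norm_nonneg _)).trans (hVlow _)
    induction k with
    | zero => simp
    | succ k ih =>
      have hle : q ^ k * V (w - z) ≤ V (w - z) :=
        mul_le_of_le_one_left hV0 (pow_le_one₀ hq0.le hq1.le)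
      have hlt : ‖T^[k] w - z‖ < r :=
        lt_of_mul_lt_mul_left ((hVlow _).trans_lt ((ih.trans hle).trans_lt hw)) hc.le
      rw [Function.iterate_succ_apply']
      calc _ ≤ q * V (T^[k] w - z) := hstep _ hlt
        _ ≤ q * (q ^ k * V (w - z)) := by gcongr
        _ = _ := by ring
  have hinit : ∀ η > 0, ∀ w, ‖w - z‖ < c * η / D → V (w - z) < c * η := fun η _ w hw =>
    (hVup _).trans_lt (by rwa [lt_div_iff₀' hD0] at hw)
  refine ⟨hfix, fun η hη => ?_, c * r / D, by positivity, fun w hw => ?_⟩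
  · have hm : 0 < min r η := lt_min hr hη
    refine ⟨c * min r η / D, by positivity, fun w hw k => ?_⟩
    have hV := hinit _ hm w hw
    have hV0 : 0 ≤ V (w - z) := (mul_nonneg hc.le (norm_nonneg _)).trans (hVlow _)
    have hk := hiter w (hV.trans_le (by gcongr; exact min_le_left _ _)) k
    have hle : q ^ k * V (w - z) ≤ V (w - z) :=
      mul_le_of_le_one_left hV0 (pow_le_one₀ hq0.le hq1.le)
    exact (lt_of_mul_lt_mul_left ((hVlow _).trans_lt ((hk.trans hle).trans_lt hV)) hc.le).trans_le
      (min_le_right _ _)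
  · have hk := hiter w (hinit r hr w hw)
    rw [tendsto_iff_norm_sub_tendsto_zero]
    have hlim : Tendsto (fun k : ℕ => c⁻¹ * (q ^ k * V (w - z))) atTop (𝓝 0) := by
      simpa using ((tendsto_pow_atTop_nhds_zero_of_lt_one hq0.le hq1).mul_const _).const_mul c⁻¹
    refine squeeze_zero (fun _ => norm_nonneg _) (fun k => ?_) hlim
    rw [le_inv_mul_iff₀ hc]
    exact (hVlow _).trans (hk k)

/-- Product rule at a zero of the second factor: the first factor need only be continuous. -/
theorem HasFDerivAt.mul_of_continuousAt_of_eq_zero {Z : Type*} [NormedAddCommGroup Z]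
    [NormedSpace ℝ Z] {a h : Z → ℝ} {h' : Z →L[ℝ] ℝ} {z : Z} (hh : HasFDerivAt h h' z)
    (ha : ContinuousAt a z) (h0 : h z = 0) : HasFDerivAt (fun w => a w * h w) (a z • h') z := by
  have h1 : (fun w => (a w - a z) * (h w - h z)) =o[𝓝 z] fun w => (1 : ℝ) * ‖w - z‖ := by
    refine Asymptotics.IsLittleO.mul_isBigO ?_ hh.isBigO_sub.norm_right
    rw [Asymptotics.isLittleO_one_iff]
    simpa using ha.sub_const (a z)
  have h2 := (hh.isLittleO.const_mul_left (a z)).norm_right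
  refine HasFDerivAt.of_isLittleO (Asymptotics.IsLittleO.of_norm_right ?_)
  simp only [one_mul] at h1
  refine (h1.add h2).congr_left fun w => ?_
  simp [h0]
  ring

/-- Product rule for `Q(w) g(w)` at a zero of `g`: the matrix `Q` need only be continuous. -/
theorem HasFDerivAt.mulVec_of_continuousAt_of_eq_zero {Z ι : Type*} [NormedAddCommGroup Z]
    [NormedSpace ℝ Z] [Fintype ι] {Q : Z → Matrix ι ι ℝ} {g : Z → ι → ℝ} {g' : Z →L[ℝ] ι → ℝ}
    {z : Z} (hg : HasFDerivAt g g' z) (hQ : ContinuousAt Q z) (h0 : g z = 0) :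
    HasFDerivAt (fun w => Q w *ᵥ g w) ((Q z).mulVecLin.toContinuousLinearMap ∘L g') z := by
  refine hasFDerivAt_pi'.2 fun i => ?_
  have hsum := HasFDerivAt.fun_sum (u := Finset.univ) fun j _ =>
    (hasFDerivAt_pi'.1 hg j).mul_of_continuousAt_of_eq_zero
      (continuousAt_pi.1 (continuousAt_pi.1 hQ i) j) (congrFun h0 j)
  refine hsum.congr_fderiv ?_
  ext v
  simp [mulVec, dotProduct]

theorem gradient_apply {φ : EuclideanSpace ℝ (Fin n) → ℝ} {x : EuclideanSpace ℝ (Fin n)}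
    (i : Fin n) : gradient φ x i = pd φ x i := by
  rw [pd, ← inner_gradient_left, EuclideanSpace.inner_single_right]
  simp

theorem fderiv_apply_eq_sum_pd (φ : EuclideanSpace ℝ (Fin n) → ℝ) (x v : EuclideanSpace ℝ (Fin n)) :
    fderiv ℝ φ x v = ∑ k, pd φ x k * v k := by
  have hv : v = ∑ k, v k • EuclideanSpace.single k (1 : ℝ) := by
    ext i; simp [Pi.single_apply]
  conv_lhs => rw [hv]
  simp [pd, mul_comm]

theorem ContDiff.pd {φ : EuclideanSpace ℝ (Fin n) → ℝ} (hφ : ContDiff ℝ 2 φ) (i : Fin n) :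
    ContDiff ℝ 1 fun x => pd φ x i :=
  (hφ.fderiv_right (m := 1) (by norm_num)).clm_apply contDiff_const

/-- The primal-dual variables as a single coordinate vector. -/
def ZMin.coord (n l m : ℕ) : ZMin n l m ≃L[ℝ] (ιMin n l m → ℝ) :=
  LinearEquiv.toContinuousLinearEquiv
    { toFun := fun z => Sum.elim (Sum.elim z.1 z.2.1) (Sum.elim z.2.2.1 z.2.2.2)
      invFun := fun d => ((WithLp.equiv 2 (Fin n → ℝ)).symm fun i => d (Sum.inl (Sum.inl i)),
        fun i => d (Sum.inl (Sum.inr i)), fun j => d (Sum.inr (Sum.inl j)),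
        fun i => d (Sum.inr (Sum.inr i)))
      map_add' := fun z w => by ext ((i | i) | (i | i)) <;> rfl
      map_smul' := fun c z => by ext ((i | i) | (i | i)) <;> rfl
      left_inv := fun z => rfl
      right_inv := fun d => by ext ((i | i) | (i | i)) <;> rfl }

theorem ZMin.coord_apply (z : ZMin n l m) :
    ZMin.coord n l m z = Sum.elim (Sum.elim z.1 z.2.1) (Sum.elim z.2.2.1 z.2.2.2) := rfl

variable {f : EuclideanSpace ℝ (Fin n) → ℝ} {G : EuclideanSpace ℝ (Fin n) → Fin l → ℝ}
  {F : EuclideanSpace ℝ (Fin n) → Fin m → ℝ} {ε : ZMin n l m → ℝ} {b : ℝ}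

theorem contDiff_lagrangianMin (hf : ContDiff ℝ 2 f) (hG : ContDiff ℝ 2 G) (hF : ContDiff ℝ 2 F)
    (z : ZMin n l m) : ContDiff ℝ 2 (LagrangianMin f G F z) := by
  have hG' := contDiff_pi.1 hG
  have hF' := contDiff_pi.1 hF
  unfold LagrangianMin
  fun_prop

/-- The gradient of the Lagrangian is affine in the multipliers. -/
theorem pd_lagrangianMin (hf : ContDiff ℝ 2 f) (hG : ContDiff ℝ 2 G) (hF : ContDiff ℝ 2 F)
    (z w : ZMin n l m) (x : EuclideanSpace ℝ (Fin n)) (i : Fin n) :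
    pd (LagrangianMin f G F w) x i = pd (LagrangianMin f G F z) x i
      + ∑ j, pd (fun x' => G x' j) x i * (w.2.2.1 j - z.2.2.1 j)
      + ∑ j, pd (fun x' => F x' j) x i * (w.2.2.2 j - z.2.2.2 j) := by
  have key : ∀ z : ZMin n l m, pd (LagrangianMin f G F z) x i = pd f x i
      + ∑ j, z.2.2.1 j * pd (fun x' => G x' j) x i
      + ∑ j, z.2.2.2 j * pd (fun x' => F x' j) x i := by
    intro z
    have hf' := (hf.differentiable two_ne_zero x).hasFDerivAt
    have hG' := fun j => ((contDiff_pi.1 hG j).differentiable two_ne_zero x).hasFDerivAt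
    have hF' := fun j => ((contDiff_pi.1 hF j).differentiable two_ne_zero x).hasFDerivAt
    have h := (hf'.add (HasFDerivAt.fun_sum (u := Finset.univ) fun j _ =>
      (hG' j).const_mul (z.2.2.1 j))).add (HasFDerivAt.fun_sum (u := Finset.univ) fun j _ =>
      ((hF' j).add_const (z.2.1 j)).const_mul (z.2.2.2 j))
    have h' : HasFDerivAt (LagrangianMin f G F z) _ x := h
    simp [pd, h'.fderiv]
  rw [key w, key z]
  simp only [mul_comm (pd _ _ _), sub_mul, Finset.sum_sub_distrib]
  ring

theorem sMin_mul_JzzMin_mulVec_coord (z v : ZMin n l m) :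
    (SMin z * JzzMin f G F z) *ᵥ ZMin.coord n l m v = Sum.elim
      (Sum.elim
        (fun i => ∑ k, hessian (LagrangianMin f G F z) z.1 i k * v.1 k
          + (∑ j, pd (fun x' => G x' j) z.1 i * v.2.2.1 j
            + ∑ j, pd (fun x' => F x' j) z.1 i * v.2.2.2 j))
        (fun i => z.2.1 i * (z.2.2.2 i / z.2.1 i * v.2.1 i + v.2.2.2 i)))
      (Sum.elim
        (fun j => ∑ k, pd (fun x' => G x' j) z.1 k * v.1 k)
        (fun i => ∑ k, pd (fun x' => F x' i) z.1 k * v.1 k + v.2.1 i)) := by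
  rw [← mulVec_mulVec, SMin, JzzMin, ZMin.coord_apply]
  ext ((i | i) | (i | i)) <;> rw [mulVec_diagonal] <;>
    simp [fromBlocks_mulVec, fromBlocks_transpose, mulVec_diagonal, Sum.elim_comp_inl,
      Sum.elim_comp_inr] <;> simp [mulVec, dotProduct]

/-- At a point where the slacks do not vanish, the derivative of `g(·, b)` is `S(z) J_zz f(z)`. -/
theorem hasFDerivAt_gMin (hf : ContDiff ℝ 2 f) (hG : ContDiff ℝ 2 G) (hF : ContDiff ℝ 2 F)
    {z : ZMin n l m} (hs : ∀ i, z.2.1 i ≠ 0) (hJ : (JzzMin f G F z).IsHermitian) :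
    HasFDerivAt (fun w => gMin f G F w b)
      ((SMin z * JzzMin f G F z).mulVecLin.toContinuousLinearMap ∘L
        (ZMin.coord n l m : ZMin n l m →L[ℝ] ιMin n l m → ℝ)) z := by
  have hG' := contDiff_pi.1 hG
  have hF' := contDiff_pi.1 hF
  have hfst : HasFDerivAt (fun w : ZMin n l m => w.1) (ContinuousLinearMap.fst ℝ _ _) z :=
    hasFDerivAt_fst
  have hcoord := fun k => hasFDerivAt_pi'.1 ((ZMin.coord n l m).hasFDerivAt (x := z)) k
  have hsymm : ∀ i k, hessian (LagrangianMin f G F z) z.1 i k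
      = hessian (LagrangianMin f G F z) z.1 k i := fun i k => by
    simpa [JzzMin] using hJ.apply (Sum.inl (Sum.inl k)) (Sum.inl (Sum.inl i))
  refine hasFDerivAt_pi'.2 ?_
  rintro ((i | i) | (j | i))
  · have h0 : HasFDerivAt (fun w : ZMin n l m => pd (LagrangianMin f G F z) w.1 i) _ z :=
      (((contDiff_lagrangianMin hf hG hF z).pd i).differentiable one_ne_zero
        z.1).hasFDerivAt.comp z hfst
    have h1 := HasFDerivAt.fun_sum (u := Finset.univ) fun j (_ : j ∈ Finset.univ) =>
      ((hcoord (Sum.inr (Sum.inl j))).sub_const (z.2.2.1 j)).mul_of_continuousAt_of_eq_zero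
        (a := fun w => pd (fun x' => G x' j) w.1 i)
        (((hG' j).pd i).continuous.comp continuous_fst).continuousAt (sub_self _)
    have h2 := HasFDerivAt.fun_sum (u := Finset.univ) fun j (_ : j ∈ Finset.univ) =>
      ((hcoord (Sum.inr (Sum.inr j))).sub_const (z.2.2.2 j)).mul_of_continuousAt_of_eq_zero
        (a := fun w => pd (fun x' => F x' j) w.1 i)
        (((hF' j).pd i).continuous.comp continuous_fst).continuousAt (sub_self _)
    refine (((h0.add h1).add h2).congr_of_eventuallyEq (.of_forall fun w => ?_)).congr_fderiv ?_
    · simp only [gMin, Sum.elim_inl, gradient_apply]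
      exact pd_lagrangianMin hf hG hF z w w.1 i
    · refine ContinuousLinearMap.ext fun v => ?_
      have hv : ((SMin z * JzzMin f G F z) *ᵥ ZMin.coord n l m v) (Sum.inl (Sum.inl i)) = _ :=
        congrFun (sMin_mul_JzzMin_mulVec_coord z v) _
      rw [ZMin.coord_apply] at hv
      have hH : ∀ k, pd (fun x => pd (LagrangianMin f G F z) x i) z.1 k
          = hessian (LagrangianMin f G F z) z.1 i k := fun k => hsymm k i
      simp [hv, hH, fderiv_apply_eq_sum_pd, ZMin.coord_apply, add_assoc]
  · have h := ((hcoord (Sum.inr (Sum.inr i))).mul (hcoord (Sum.inl (Sum.inr i)))).sub_const b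
    refine h.congr_fderiv (ContinuousLinearMap.ext fun v => ?_)
    have hv : ((SMin z * JzzMin f G F z) *ᵥ ZMin.coord n l m v) (Sum.inl (Sum.inr i)) = _ :=
      congrFun (sMin_mul_JzzMin_mulVec_coord z v) _
    rw [ZMin.coord_apply] at hv
    have hsi := hs i
    simp [hv, ZMin.coord_apply]
    field_simp
  · have h : HasFDerivAt (fun w : ZMin n l m => G w.1 j) _ z :=
      (((hG' j).differentiable two_ne_zero) z.1).hasFDerivAt.comp z hfst
    refine h.congr_fderiv (ContinuousLinearMap.ext fun v => ?_)
    have hv : ((SMin z * JzzMin f G F z) *ᵥ ZMin.coord n l m v) (Sum.inr (Sum.inl j)) = _ :=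
      congrFun (sMin_mul_JzzMin_mulVec_coord z v) _
    simp [hv, fderiv_apply_eq_sum_pd]
  · have h : HasFDerivAt (fun w : ZMin n l m => F w.1 i) _ z :=
      (((hF' i).differentiable two_ne_zero) z.1).hasFDerivAt.comp z hfst
    refine (h.add (hcoord (Sum.inl (Sum.inr i)))).congr_fderiv
      (ContinuousLinearMap.ext fun v => ?_)
    have hv : ((SMin z * JzzMin f G F z) *ᵥ ZMin.coord n l m v) (Sum.inr (Sum.inr i)) = _ :=
      congrFun (sMin_mul_JzzMin_mulVec_coord z v) _
    rw [ZMin.coord_apply] at hv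
    simp [hv, fderiv_apply_eq_sum_pd, ZMin.coord_apply]

theorem ipMinMap_eq (z : ZMin n l m) : ipMinMap f G F ε b z = z - (ZMin.coord n l m).symm
    (((JzzMin f G F z + EMin ε z)⁻¹ * (SMin z)⁻¹) *ᵥ gMin f G F z b) := by
  rw [← mulVec_mulVec]
  rfl

theorem isUnit_det_SMin {z : ZMin n l m} (hs : ∀ i, z.2.1 i ≠ 0) : IsUnit (SMin z).det := by
  simp [SMin, isUnit_iff_ne_zero, Finset.prod_ne_zero_iff, hs]

theorem continuousAt_modified_inv {z : ZMin n l m} (hs : ∀ i, z.2.1 i ≠ 0)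
    (hJ : ContinuousAt (JzzMin f G F) z) (hε : ∀ᶠ w in 𝓝 z, ε w = ε z)
    (hdet : IsUnit (JzzMin f G F z + EMin ε z).det) :
    ContinuousAt (fun w => (JzzMin f G F w + EMin ε w)⁻¹ * (SMin w)⁻¹) z := by
  have hinv : ∀ A : Matrix (ιMin n l m) (ιMin n l m) ℝ, IsUnit A.det →
      ContinuousAt Inv.inv A := fun A hA =>
    continuousAt_matrix_inv A (by
      simpa [Ring.inverse_eq_inv'] using continuousAt_inv₀ hA.ne_zero)
  have hE : ContinuousAt (EMin ε) z := by
    refine (continuousAt_const (y := EMin ε z)).congr (hε.mono fun w hw => ?_)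
    simp [EMin, hw]
  have hS : Continuous (SMin : ZMin n l m → _) := by
    refine Continuous.matrix_diagonal (continuous_pi ?_)
    rintro ((i | i) | i) <;> simp only [Sum.elim_inl, Sum.elim_inr] <;> fun_prop
  exact (ContinuousAt.comp (f := fun w => JzzMin f G F w + EMin ε w) (hinv _ hdet)
    (hJ.add hE)).mul
    (ContinuousAt.comp (hinv _ (isUnit_det_SMin hs)) hS.continuousAt)

/-- At an equilibrium, the derivative of the iteration is `(J_zz f(z) + E(z))⁻¹ E(z)`. -/
theorem hasFDerivAt_ipMinMap (hf : ContDiff ℝ 2 f) (hG : ContDiff ℝ 2 G) (hF : ContDiff ℝ 2 F)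
    {z : ZMin n l m} (heq : gMin f G F z b = 0) (hs : ∀ i, z.2.1 i ≠ 0)
    (hJsymm : (JzzMin f G F z).IsHermitian)
    (hJ : ContinuousAt (JzzMin f G F) z) (hε : ∀ᶠ w in 𝓝 z, ε w = ε z)
    (hdet : IsUnit (JzzMin f G F z + EMin ε z).det) :
    HasFDerivAt (ipMinMap f G F ε b)
      (((ZMin.coord n l m).symm : (ιMin n l m → ℝ) →L[ℝ] ZMin n l m) ∘L
        ((JzzMin f G F z + EMin ε z)⁻¹ * EMin ε z).mulVecLin.toContinuousLinearMap ∘L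
        (ZMin.coord n l m : ZMin n l m →L[ℝ] ιMin n l m → ℝ)) z := by
  have hd := (hasFDerivAt_gMin (b := b) hf hG hF hs hJsymm).mulVec_of_continuousAt_of_eq_zero
    (continuousAt_modified_inv hs hJ hε hdet) heq
  have h := (hasFDerivAt_id z).sub ((ZMin.coord n l m).symm.hasFDerivAt.comp z hd)
  refine (h.congr_of_eventuallyEq (.of_forall ipMinMap_eq)).congr_fderiv
    (ContinuousLinearMap.ext fun v => (ZMin.coord n l m).injective ?_)
  have hQ : (JzzMin f G F z + EMin ε z)⁻¹ * (SMin z)⁻¹ * (SMin z * JzzMin f G F z)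
      = 1 - (JzzMin f G F z + EMin ε z)⁻¹ * EMin ε z := by
    rw [Matrix.mul_assoc, Matrix.nonsing_inv_mul_cancel_left _ _ (isUnit_det_SMin hs),
      eq_sub_iff_add_eq, ← Matrix.mul_add, Matrix.nonsing_inv_mul _ hdet]
  have hQv := congrArg (fun B => B *ᵥ ZMin.coord n l m v) hQ
  simp only [sub_mulVec, one_mulVec, ← mulVec_mulVec] at hQv
  simp [-mulVec_mulVec, hQv]

/-- **Theorem (stability part)**: if the second order sufficient conditions hold at an
equilibrium point of the modified primal-dual interior-point method, then it is a locally
asymptotically stable equilibrium. -/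
theorem ipMin_LAS_of_secondOrder
    (f : EuclideanSpace ℝ (Fin n) → ℝ) (G : EuclideanSpace ℝ (Fin n) → Fin l → ℝ)
    (F : EuclideanSpace ℝ (Fin n) → Fin m → ℝ)
    (hf : ContDiff ℝ 2 f) (hG : ContDiff ℝ 2 G) (hF : ContDiff ℝ 2 F)
    (b : ℝ) (hb : 0 < b) (zs : ZMin n l m)
    (heq : gMin f G F zs b = 0)
    -- LICQ :
    (hLICQ : LinearIndependent ℝ
      (Sum.elim (fun j : Fin l => gradient (fun x' => G x' j) zs.1)
        (fun i : {i : Fin m // F zs.1 i = 0} => gradient (fun x' => F x' i.1) zs.1)))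
    -- strict complementarity :
    (hstrict : ∀ i, F zs.1 i = 0 → 0 < zs.2.2.2 i)
    (hinv : IsUnit (JzzMin f G F zs).det)
    (hJdiff : ∀ᶠ w in 𝓝 zs, ∀ i j, DifferentiableAt ℝ (fun w' => JzzMin f G F w' i j) w)
    (ε : ZMin n l m → ℝ) (hε0 : ∀ z, 0 ≤ ε z)
    (hεconst : ∀ᶠ w in 𝓝 zs, ε w = ε zs)
    (hεinertia : HasInertia (JzzMin f G F zs + EMin ε zs) (n + m, l + m, 0))
    -- second order sufficient conditions for a local minimum :
    (hsecond : HasInertia (JzzMin f G F zs) (n + m, l + m, 0)) :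
    IsLASFixedPt (ipMinMap f G F ε b) zs := by
  have hs : ∀ i, zs.2.1 i ≠ 0 := fun i hi => by
    have h := congrFun heq (Sum.inl (Sum.inr i))
    simp only [gMin, Sum.elim_inl, Sum.elim_inr, hi, mul_zero, zero_sub, Pi.zero_apply] at h
    linarith
  have hdet := hεinertia.isUnit_det
  have hJ : ContinuousAt (JzzMin f G F) zs := continuousAt_pi.2 fun i => continuousAt_pi.2 fun j =>
    (hJdiff.self_of_nhds i j).continuousAt
  have hT := hasFDerivAt_ipMinMap hf hG hF heq hs hsecond.1 hJ hεconst hdet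
  have hfix : Function.IsFixedPt (ipMinMap f G F ε b) zs := by
    simp [Function.IsFixedPt, ipMinMap_eq, heq]
  let r : Fin n ⊕ Fin m → ℝ := Sum.elim (fun _ => √(ε zs)) fun _ => 0
  have hE : EMin ε zs = fromBlocks (diagonal (r ^ 2)) 0 0 0 := by
    ext ((i | i) | i) ((j | j) | j) <;>
      simp [EMin, r, diagonal_apply, Real.sq_sqrt (hε0 zs)]
  let H : Matrix (Fin n ⊕ Fin m) (Fin n ⊕ Fin m) ℝ := fromBlocks
    (hessian (LagrangianMin f G F zs) zs.1) 0 0 (diagonal fun i => zs.2.2.2 i / zs.2.1 i)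
  let A : Matrix (Fin n ⊕ Fin m) (Fin l ⊕ Fin m) ℝ := fromBlocks
    (of fun i j => pd (fun x' => G x' j) zs.1 i) (of fun i j => pd (fun x' => F x' j) zs.1 i) 0 1
  have hJHA : JzzMin f G F zs = fromBlocks H A Aᵀ 0 := rfl
  have hK : JzzMin f G F zs + EMin ε zs = fromBlocks (H + diagonal (r ^ 2)) A Aᵀ 0 := by
    simp [hJHA, hE, fromBlocks_add]
  obtain ⟨θ, hθ0, hθ1, hθ⟩ := exists_contraction_of_regularized (H := H) (A := A) (p := n + m)
    (by simpa [← hJHA] using hsecond) r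
  let R : ZMin n l m →L[ℝ] EuclideanSpace ℝ (Fin n ⊕ Fin m) := LinearMap.toContinuousLinearMap
    ((WithLp.linearEquiv 2 ℝ (Fin n ⊕ Fin m → ℝ)).symm.toLinearMap ∘ₗ LinearMap.mulLeft ℝ r ∘ₗ
      LinearMap.funLeft ℝ ℝ Sum.inl ∘ₗ (ZMin.coord n l m).toLinearEquiv.toLinearMap)
  let D : Matrix (ιMin n l m) (Fin n ⊕ Fin m) ℝ := fromRows (diagonal r) 0
  let N : EuclideanSpace ℝ (Fin n ⊕ Fin m) →L[ℝ] ZMin n l m := LinearMap.toContinuousLinearMap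
    ((ZMin.coord n l m).symm.toLinearEquiv.toLinearMap ∘ₗ
      ((JzzMin f G F zs + EMin ε zs)⁻¹ * D).mulVecLin ∘ₗ
      (WithLp.linearEquiv 2 ℝ (Fin n ⊕ Fin m → ℝ)).toLinearMap)
  have hR : ∀ v, R v = WithLp.toLp 2 (r * (ZMin.coord n l m v ∘ Sum.inl)) := fun v => rfl
  refine isLASFixedPt_of_hasFDerivAt hfix hT R (C := ‖N‖) hθ0 hθ1 (fun v => ?_) fun v => ?_
  · rw [hR, hR]
    refine hθ _ _ ?_
    rw [← hK, ← hE]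
    simp [mulVec_mulVec, Matrix.mul_nonsing_inv_cancel_left _ _ hdet]
  · have hEv : EMin ε zs *ᵥ ZMin.coord n l m v
        = D *ᵥ (r * (ZMin.coord n l m v ∘ Sum.inl)) := by
      rw [hE, fromBlocks_mulVec, fromRows_mulVec]
      ext (i | i)
      · simp [mulVec_diagonal, sq, mul_assoc]
      · simp
    have hN : N (R v) = (ZMin.coord n l m).symm
        (((JzzMin f G F zs + EMin ε zs)⁻¹ * D) *ᵥ (r * (ZMin.coord n l m v ∘ Sum.inl))) := rfl
    refine le_of_eq_of_le (congrArg _ ?_) (N.le_opNorm (R v))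
    rw [hN, ← mulVec_mulVec, ← hEv]
    simp [mulVec_mulVec]
end
end
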